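/- Let R be a commutative quasi-Frobenius ring and I a proper ideal of R. Then the amalgamated duplication R⋈I is quasi-Frobenius if and only if R is projective as an R⋈I-module (via the surjection ε : R⋈I → R, (r, r+i) ↦ r). -/

import Mathlib

/-- The amalgamated duplication of a commutative ring `R` along an ideal `I`,
realized as the subring `{(x, y) ∈ R × R : y - x ∈ I}` of `R × R`. -/
def amalgDup (R : Type*) [CommRing R] (I : Ideal R) : Subring (R × R) where
  carrier := {p | p.2 - p.1 ∈ I}
  zero_mem' := by simp
  one_mem' := by simp
  add_mem' := by
    intro a b ha hb
    have := I.add_mem ha hb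
    simpa [add_sub_add_comm] using this
  neg_mem' := by
    intro a ha
    show -a.2 - -a.1 ∈ I
    have h : -a.2 - -a.1 = -(a.2 - a.1) := by ring
    rw [h]; exact I.neg_mem ha
  mul_mem' := by
    intro a b ha hb
    have : a.2 * b.2 - a.1 * b.1 = (a.2 - a.1) * b.2 + a.1 * (b.2 - b.1) := by ring
    show a.2 * b.2 - a.1 * b.1 ∈ I
    rw [this]
    exact I.add_mem (I.mul_mem_right _ ha) (I.mul_mem_left _ hb)

/-- A commutative ring is quasi-Frobenius if it is Noetherian and self-injective. -/
def IsQuasiFrobenius (R : Type*) [CommRing R] : Prop :=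
  IsNoetherianRing R ∧ Module.Injective R R

/-- The canonical surjection `ε : R⋈I → R`, `(r, r+i) ↦ r`. -/
def epsHom (R : Type*) [CommRing R] (I : Ideal R) : amalgDup R I →+* R :=
  (RingHom.fst R R).comp (amalgDup R I).subtype

/-- `R` as a module over `R⋈I` via the surjection `ε`. -/
instance epsModule (R : Type*) [CommRing R] (I : Ideal R) :
    Module (amalgDup R I) R :=
  Module.compHom R (epsHom R I)

theorem Module.Injective.exists_mul_eq {R : Type*} [CommRing R] [Module.Injective R R]
    (J : Ideal R) (f : J →ₗ[R] R) : ∃ c : R, ∀ j : J, f j = c * j := by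
  obtain ⟨g, hg⟩ := Module.Injective.out (R := R) (Q := R) J.subtype J.injective_subtype f
  refine ⟨g 1, fun j ↦ ?_⟩
  rw [← hg j, mul_comm, ← smul_eq_mul, ← map_smul]
  simp

theorem Module.Injective.of_forall_exists_mul_eq {R : Type*} [CommRing R]
    (h : ∀ (J : Ideal R) (f : J →ₗ[R] R), ∃ c : R, ∀ j : J, f j = c * j) :
    Module.Injective R R := by
  refine Module.Baer.injective fun J f ↦ ?_
  obtain ⟨c, hc⟩ := h J f
  exact ⟨LinearMap.mulLeft R c, fun x hx ↦ by simp [hc ⟨x, hx⟩]⟩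

theorem Module.Injective.prod_self {R S : Type*} [CommRing R] [CommRing S]
    [Module.Injective R R] [Module.Injective S S] : Module.Injective (R × S) (R × S) := by
  refine .of_forall_exists_mul_eq fun J f ↦ ?_
  let J₁ : Ideal R :=
    { carrier := {x | ((x, 0) : R × S) ∈ J}
      zero_mem' := J.zero_mem
      add_mem' := fun ha hb ↦ by simpa using J.add_mem ha hb
      smul_mem' := fun r x hx ↦ by simpa using J.mul_mem_left (r, 0) hx }
  let J₂ : Ideal S :=
    { carrier := {x | ((0, x) : R × S) ∈ J}
      zero_mem' := J.zero_mem
      add_mem' := fun ha hb ↦ by simpa using J.add_mem ha hb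
      smul_mem' := fun r x hx ↦ by simpa using J.mul_mem_left (0, r) hx }
  let f₁ : J₁ →ₗ[R] R :=
    { toFun := fun x ↦ (f ⟨(x, 0), x.2⟩).1
      map_add' := fun x y ↦ by
        rw [← Prod.fst_add, ← map_add]
        congr 3
        ext <;> simp
      map_smul' := fun r x ↦ by
        have h := congrArg Prod.fst (f.map_smul ((r, 0) : R × S) ⟨(x, 0), x.2⟩)
        simp only [smul_eq_mul, Prod.fst_mul] at h
        rw [RingHom.id_apply, smul_eq_mul, ← h]
        congr 3
        ext <;> simp }
  let f₂ : J₂ →ₗ[S] S :=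
    { toFun := fun x ↦ (f ⟨(0, x), x.2⟩).2
      map_add' := fun x y ↦ by
        rw [← Prod.snd_add, ← map_add]
        congr 3
        ext <;> simp
      map_smul' := fun r x ↦ by
        have h := congrArg Prod.snd (f.map_smul ((0, r) : R × S) ⟨(0, x), x.2⟩)
        simp only [smul_eq_mul, Prod.snd_mul] at h
        rw [RingHom.id_apply, smul_eq_mul, ← h]
        congr 3
        ext <;> simp }
  obtain ⟨c₁, h₁⟩ := exists_mul_eq J₁ f₁
  obtain ⟨c₂, h₂⟩ := exists_mul_eq J₂ f₂
  refine ⟨(c₁, c₂), fun ⟨⟨x, y⟩, hj⟩ ↦ ?_⟩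
  have hx : ((x, 0) : R × S) ∈ J := by simpa using J.mul_mem_left (1, 0) hj
  have hy : ((0, y) : R × S) ∈ J := by simpa using J.mul_mem_left (0, 1) hj
  have e₁ := congrArg Prod.fst (f.map_smul ((1, 0) : R × S) ⟨(x, y), hj⟩)
  have e₂ := congrArg Prod.snd (f.map_smul ((0, 1) : R × S) ⟨(x, y), hj⟩)
  have h₁' : (f ⟨(x, 0), hx⟩).1 = c₁ * x := h₁ ⟨x, hx⟩
  have h₂' : (f ⟨(0, y), hy⟩).2 = c₂ * y := h₂ ⟨y, hy⟩
  simp only [SetLike.mk_smul_mk, smul_eq_mul, Prod.mk_mul_mk, one_mul, zero_mul, Prod.fst_mul,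
    Prod.snd_mul] at e₁ e₂
  exact Prod.ext (e₁.symm.trans h₁') (e₂.symm.trans h₂')

/-- Self-injectivity passes to a quotient ring which is a direct summand as a module. -/
theorem Module.Injective.self_of_rightInverse {S A : Type*} [CommRing S] [CommRing A]
    [Module.Injective S S] (φ : S →+* A) (ψ : A →+ S) (hφψ : Function.RightInverse ψ φ)
    (hψ : ∀ s a, ψ (φ s * a) = s * ψ a) : Module.Injective A A := by
  refine .of_forall_exists_mul_eq fun J f ↦ ?_
  let g : J.comap φ →ₗ[S] S :=
    { toFun := fun x ↦ ψ (f ⟨φ x, x.2⟩)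
      map_add' := fun x y ↦ by
        rw [← map_add, ← map_add]
        congr 2
        ext
        simp
      map_smul' := fun r x ↦ by
        rw [RingHom.id_apply, smul_eq_mul, ← hψ, ← smul_eq_mul (φ r), ← map_smul]
        congr 2
        ext
        simp }
  obtain ⟨c, hc⟩ := exists_mul_eq _ g
  refine ⟨φ c, fun ⟨j, hj⟩ ↦ ?_⟩
  have h : ψ (f ⟨φ (ψ j), _⟩) = c * ψ j :=
    hc ⟨ψ j, by rw [Ideal.mem_comap, hφψ]; exact hj⟩
  simp only [hφψ j] at h
  rw [← hφψ (f _), h, map_mul, hφψ]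

/-- The double annihilator property of finitely generated ideals in a self-injective ring. -/
theorem Ideal.FG.mem_of_forall_mul_eq_zero {R : Type*} [CommRing R] [Module.Injective R R]
    {J : Ideal R} (hJ : J.FG) {a : R} (ha : ∀ r, (∀ j ∈ J, r * j = 0) → r * a = 0) :
    a ∈ J := by
  obtain ⟨n, b, rfl⟩ := Submodule.fg_iff_exists_fin_generating_family.mp hJ
  let F : R →ₗ[R] Fin n → R := LinearMap.toSpanSingleton R _ b
  have hF : LinearMap.ker F ≤ LinearMap.ker (LinearMap.toSpanSingleton R R a) := by
    intro r hr
    refine ha r fun j hj ↦ ?_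
    have hr' : ∀ i, r * b i = 0 := fun i ↦ congrFun (hr : r • b = 0) i
    induction hj using Submodule.span_induction with
    | mem x hx => obtain ⟨i, rfl⟩ := hx; exact hr' i
    | zero => simp
    | add x y _ _ hx hy => rw [mul_add, hx, hy, add_zero]
    | smul c x _ hx => rw [smul_eq_mul, mul_left_comm, hx, mul_zero]
  obtain ⟨g, hg⟩ := Module.Injective.out (R := R) (Q := R) ((LinearMap.ker F).liftQ F le_rfl)
    (LinearMap.ker_eq_bot.mp (Submodule.ker_liftQ_eq_bot' _ _ rfl)) ((LinearMap.ker F).liftQ _ hF)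
  have h1 : g b = a := by
    have h := hg (Submodule.Quotient.mk 1)
    rw [Submodule.liftQ_apply, Submodule.liftQ_apply] at h
    simpa [F] using h
  rw [← h1, LinearMap.pi_apply_eq_sum_univ g b]
  exact Submodule.sum_mem _ fun i _ ↦
    Ideal.mul_mem_right _ _ (Ideal.subset_span ⟨i, rfl⟩)

theorem IsQuasiFrobenius.mem_of_forall_mul_eq_zero {R : Type*} [CommRing R]
    (hR : IsQuasiFrobenius R) {J : Ideal R} {a : R}
    (ha : ∀ r, (∀ j ∈ J, r * j = 0) → r * a = 0) : a ∈ J :=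
  have := hR.1
  have := hR.2
  Ideal.FG.mem_of_forall_mul_eq_zero (IsNoetherian.noetherian J) ha

theorem IsQuasiFrobenius.prod {R S : Type*} [CommRing R] [CommRing S]
    (hR : IsQuasiFrobenius R) (hS : IsQuasiFrobenius S) : IsQuasiFrobenius (R × S) :=
  have := hR.1
  have := hR.2
  have := hS.1
  have := hS.2
  ⟨inferInstance, .prod_self⟩

section amalgDup

variable {R : Type*} [CommRing R] {I : Ideal R}

theorem mem_amalgDup {p : R × R} : p ∈ amalgDup R I ↔ p.2 - p.1 ∈ I := Iff.rfl

theorem amalgDup_projective_iff :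
    Module.Projective (amalgDup R I) R ↔ ∃ e ∈ I, ∀ i ∈ I, i * e = i := by
  constructor
  · intro _
    let ε : amalgDup R I →ₗ[amalgDup R I] R :=
      { toFun := epsHom R I
        map_add' := map_add _
        map_smul' := fun a b ↦ map_mul _ a b }
    have hε : Function.Surjective ε := fun r ↦ ⟨⟨(r, r), by simp [mem_amalgDup]⟩, rfl⟩
    obtain ⟨s, hs⟩ := Module.projective_lifting_property ε LinearMap.id hε
    have h1 : (s 1).1.1 = 1 := LinearMap.congr_fun hs 1
    refine ⟨1 - (s 1).1.2, ?_, fun i hi ↦ ?_⟩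
    · have h := I.neg_mem (mem_amalgDup.mp (s 1).2)
      rwa [h1, neg_sub] at h
    · let k : amalgDup R I := ⟨(0, i), by simpa [mem_amalgDup] using hi⟩
      have hk : k • (1 : R) = 0 := zero_mul _
      have h := s.map_smul k 1
      rw [hk, map_zero] at h
      have h' : 0 = i * (s 1).1.2 := congrArg (fun a : amalgDup R I ↦ a.1.2) h
      rw [mul_sub, ← h', mul_one, sub_zero]
  · rintro ⟨e, he, h⟩
    let s : R →ₗ[amalgDup R I] amalgDup R I :=
      { toFun := fun r ↦ ⟨(r, r * (1 - e)), by
          rw [mem_amalgDup, show r * (1 - e) - r = -r * e by ring]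
          exact I.mul_mem_left _ he⟩
        map_add' := fun x y ↦ Subtype.ext (Prod.ext rfl (add_mul _ _ _))
        map_smul' := fun a r ↦ by
          refine Subtype.ext (Prod.ext rfl ?_)
          change a.1.1 * r * (1 - e) = a.1.2 * (r * (1 - e))
          linear_combination r * h _ a.2 }
    let ε : amalgDup R I →ₗ[amalgDup R I] R :=
      { toFun := epsHom R I
        map_add' := map_add _
        map_smul' := fun a b ↦ map_mul _ a b }
    exact Module.Projective.of_split s ε rfl

theorem IsQuasiFrobenius.amalgDup (hR : IsQuasiFrobenius R) {e : R} (he : e ∈ I)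
    (h : ∀ i ∈ I, i * e = i) : IsQuasiFrobenius (amalgDup R I) := by
  have hee : e * e = e := h e he
  let φ : R × R →+* _root_.amalgDup R I :=
    { toFun := fun p ↦ ⟨(p.1, p.1 * (1 - e) + p.2 * e), by
        rw [mem_amalgDup, show p.1 * (1 - e) + p.2 * e - p.1 = (p.2 - p.1) * e by ring]
        exact I.mul_mem_left _ he⟩
      map_one' := Subtype.ext (Prod.ext rfl (by simp))
      map_zero' := Subtype.ext (Prod.ext rfl (by simp))
      map_add' := fun p q ↦ Subtype.ext (Prod.ext rfl (by simp; ring))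
      map_mul' := fun p q ↦ Subtype.ext (Prod.ext rfl (by
        simp
        linear_combination (-p.1 * q.1 + p.1 * q.2 + p.2 * q.1 - p.2 * q.2) * hee)) }
  let ψ : _root_.amalgDup R I →+ R × R :=
    (AddMonoidHom.mulLeft (1, e)).comp (_root_.amalgDup R I).subtype.toAddMonoidHom
  have hφψ : Function.RightInverse ψ φ := by
    intro a
    refine Subtype.ext (Prod.ext (one_mul _) ?_)
    change 1 * a.1.1 * (1 - e) + e * a.1.2 * e = a.1.2
    linear_combination a.1.2 * hee + h _ a.2
  have hψ : ∀ s a, ψ (φ s * a) = s * ψ a := by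
    intro s a
    refine Prod.ext (mul_left_comm 1 s.1 a.1.1) ?_
    change e * ((s.1 * (1 - e) + s.2 * e) * a.1.2) = s.2 * (e * a.1.2)
    linear_combination (s.2 - s.1) * a.1.2 * hee
  obtain ⟨_, _⟩ := hR.prod hR
  exact ⟨isNoetherianRing_of_surjective _ _ φ hφψ.surjective, .self_of_rightInverse φ ψ hφψ hψ⟩

theorem IsQuasiFrobenius.eq_zero_of_mem_of_amalgDup (hA : IsQuasiFrobenius (_root_.amalgDup R I))
    {x : R} (hxI : x ∈ I) (hx : ∀ i ∈ I, x * i = 0) : x = 0 := by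
  let a : _root_.amalgDup R I := ⟨(x, 0), by simpa [mem_amalgDup] using hxI⟩
  suffices a ∈ RingHom.ker (epsHom R I) from this
  refine hA.mem_of_forall_mul_eq_zero fun r hr ↦ Subtype.ext (Prod.ext ?_ (mul_zero _))
  have h : r.1.2 * x = 0 := congrArg (fun a : _root_.amalgDup R I ↦ a.1.2)
    (hr ⟨(0, x), by simpa [mem_amalgDup] using hxI⟩ rfl)
  change r.1.1 * x = 0
  linear_combination h - hx _ r.2

theorem IsQuasiFrobenius.exists_mem_forall_mul_eq_of_amalgDup (hR : IsQuasiFrobenius R)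
    (hA : IsQuasiFrobenius (_root_.amalgDup R I)) : ∃ e ∈ I, ∀ i ∈ I, i * e = i := by
  have h1 : (1 : R) ∈ I ⊔ Submodule.annihilator I := by
    refine hR.mem_of_forall_mul_eq_zero fun y hy ↦ ?_
    rw [mul_one]
    refine hA.eq_zero_of_mem_of_amalgDup ?_ fun i hi ↦ hy i (Ideal.mem_sup_left hi)
    refine hR.mem_of_forall_mul_eq_zero fun n hn ↦ ?_
    rw [mul_comm]
    exact hy n (Ideal.mem_sup_right (Submodule.mem_annihilator.mpr hn))
  obtain ⟨e, he, n, hn, hen⟩ := Submodule.mem_sup.mp h1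
  refine ⟨e, he, fun i hi ↦ ?_⟩
  have hni : n * i = 0 := Submodule.mem_annihilator.mp hn i hi
  linear_combination i * hen - hni

end amalgDup

theorem amalgDup_isQuasiFrobenius_iff_projective (R : Type*) [CommRing R]
    (hR : IsQuasiFrobenius R) (I : Ideal R) (hI : I ≠ ⊤) :
    IsQuasiFrobenius (amalgDup R I) ↔ Module.Projective (amalgDup R I) R := by
  rw [amalgDup_projective_iff]
  exact ⟨hR.exists_mem_forall_mul_eq_of_amalgDup, fun ⟨_, he, h⟩ ↦ hR.amalgDup he h⟩
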